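/- Let B : W × W → W^⊥ be a symmetric bilinear map, write B_{kl} = B(e_k, e_l), set η(X) = ι(e₁)·ι(B(e₁,X)) + ι(e₂)·ι(B(e₂,X)) ∈ Cl(Q) for X ∈ W, and for ν ∈ W^⊥ let S_ν : W → W be the symmetric endomorphism determined by ⟨S_ν X, Y⟩ = ⟨B(X,Y), ν⟩ for X, Y ∈ W. Then in Cl(Q): η(e₂)·η(e₁) - η(e₁)·η(e₂) = 2(‖B₁₂‖² - ⟨B₁₁, B₂₂⟩) · ι(e₁)·ι(e₂) + 2⟨(S_{ν₁} ∘ S_{ν₂} - S_{ν₂} ∘ S_{ν₁})(e₁), e₂⟩ · ι(ν₁)·ι(ν₂). -/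

import Mathlib

open scoped RealInnerProductSpace
open CliffordAlgebra

noncomputable section

/-- `V = ℝ⁴` with the standard inner product. -/
abbrev V4 : Type := EuclideanSpace ℝ (Fin 4)

/-- The quadratic form `Q(v) = -⟨v, v⟩` on `ℝ⁴`. -/
def Q4 : QuadraticForm ℝ V4 :=
  -(LinearMap.BilinMap.toQuadraticMap (innerₗ V4))

/-- `e₁` -/ def E1 : V4 := EuclideanSpace.single 0 1
/-- `e₂` -/ def E2 : V4 := EuclideanSpace.single 1 1
/-- `ν₁` -/ def N1 : V4 := EuclideanSpace.single 2 1
/-- `ν₂` -/ def N2 : V4 := EuclideanSpace.single 3 1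

/-- The tangent plane `W = span{e₁, e₂}`. -/
def Wt : Submodule ℝ V4 := Submodule.span ℝ {E1, E2}

lemma E1_mem : E1 ∈ Wt := Submodule.subset_span (Set.mem_insert _ _)
lemma E2_mem : E2 ∈ Wt := Submodule.subset_span (Set.mem_insert_of_mem _ rfl)

/-- `e₁` as an element of `W`. -/ def e1 : ↥Wt := ⟨E1, E1_mem⟩
/-- `e₂` as an element of `W`. -/ def e2 : ↥Wt := ⟨E2, E2_mem⟩

lemma ι_mul_ι_self_eq_neg_inner (v : V4) : ι Q4 v * ι Q4 v = algebraMap ℝ _ (-⟪v, v⟫) := by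
  rw [ι_sq_scalar]
  simp [Q4]

lemma ι_mul_ι_eq_neg_of_inner_eq_zero {v w : V4} (h : ⟪v, w⟫ = 0) :
    ι Q4 v * ι Q4 w = -(ι Q4 w * ι Q4 v) := by
  have hvw := ι_mul_ι_self_eq_neg_inner (v + w)
  rw [inner_add_add_self, real_inner_comm v w, h] at hvw
  simp only [map_add, mul_add, add_mul, add_zero, neg_add, ι_mul_ι_self_eq_neg_inner] at hvw
  rw [eq_neg_iff_add_eq_zero, ← sub_eq_zero.mpr hvw]
  abel

lemma eq_add_of_mem_Wt {v : V4} (hv : v ∈ Wt) :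
    v = ⟪v, E1⟫ • E1 + ⟪v, E2⟫ • E2 := by
  obtain ⟨s, t, rfl⟩ := Submodule.mem_span_pair.mp hv
  ext i
  fin_cases i <;> simp [E1, E2, EuclideanSpace.inner_single_right]

lemma eq_add_of_mem_Wt_orthogonal {v : V4} (hv : v ∈ Wtᗮ) :
    v = ⟪v, N1⟫ • N1 + ⟪v, N2⟫ • N2 := by
  have h1 := (Submodule.mem_orthogonal _ _).mp hv E1 E1_mem
  have h2 := (Submodule.mem_orthogonal _ _).mp hv E2 E2_mem
  simp only [E1, E2, EuclideanSpace.inner_single_left, map_one, one_mul] at h1 h2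
  ext i
  fin_cases i <;> simp [N1, N2, h1, h2, EuclideanSpace.inner_single_right]

/-- The commutator identity in any algebra with four anticommuting square roots of `-1`. -/
lemma commutator_of_anticommuting {A : Type*} [Ring A] [Algebra ℝ A] {p q m n : A}
    (hpp : p * p = -1) (hqq : q * q = -1) (hmm : m * m = -1) (hnn : n * n = -1)
    (hqp : q * p = -(p * q)) (hmp : m * p = -(p * m)) (hmq : m * q = -(q * m))
    (hnp : n * p = -(p * n)) (hnq : n * q = -(q * n)) (hnm : n * m = -(m * n))
    (a₁ a₂ b₁ b₂ c₁ c₂ : ℝ) :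
    (p * (b₁ • m + b₂ • n) + q * (c₁ • m + c₂ • n)) *
          (p * (a₁ • m + a₂ • n) + q * (b₁ • m + b₂ • n)) -
        (p * (a₁ • m + a₂ • n) + q * (b₁ • m + b₂ • n)) *
          (p * (b₁ • m + b₂ • n) + q * (c₁ • m + c₂ • n)) =
      (2 * (b₁ ^ 2 + b₂ ^ 2 - (a₁ * c₁ + a₂ * c₂))) • (p * q) +
        (2 * (a₂ * b₁ + b₂ * c₁ - (a₁ * b₂ + b₁ * c₂))) • (m * n) := by
  have left {x y z : A} (h : x * y = z) (w : A) : x * (y * w) = z * w := by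
    rw [← mul_assoc, h]
  simp only [mul_add, add_mul, mul_smul_comm, smul_mul_assoc, mul_assoc, hpp, hqq, hmm, hnn,
    hqp, hnm, left hpp, left hqq, left hqp, left hmp, left hmq, left hnp, left hnq,
    neg_mul, mul_neg, one_mul, mul_one, neg_neg, smul_neg]
  module

/-- For a symmetric bilinear map `B : W × W → W^⊥`,
`η(X) = ι(e₁)·ι(B(e₁,X)) + ι(e₂)·ι(B(e₂,X))`, and the shape operators
`S_{ν₁}, S_{ν₂}` determined by `⟨S_ν X, Y⟩ = ⟨B(X,Y), ν⟩`, one has in `Cl(Q)`: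
`η(e₂)·η(e₁) - η(e₁)·η(e₂) = 2(‖B₁₂‖² - ⟨B₁₁, B₂₂⟩) ι(e₁)·ι(e₂)
  + 2⟨(S_{ν₁}∘S_{ν₂} - S_{ν₂}∘S_{ν₁})(e₁), e₂⟩ ι(ν₁)·ι(ν₂)`. -/
theorem eta_commutator_clifford
    (B : ↥Wt →ₗ[ℝ] ↥Wt →ₗ[ℝ] ↥Wtᗮ)
    (hBsymm : ∀ X Y : ↥Wt, B X Y = B Y X)
    (η : ↥Wt → CliffordAlgebra Q4)
    (hη : ∀ X : ↥Wt, η X =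
      ι Q4 E1 * ι Q4 ((B e1 X : ↥Wtᗮ) : V4) + ι Q4 E2 * ι Q4 ((B e2 X : ↥Wtᗮ) : V4))
    (S1 S2 : ↥Wt →ₗ[ℝ] ↥Wt)
    (hS1 : ∀ X Y : ↥Wt, ⟪((S1 X : ↥Wt) : V4), (Y : V4)⟫ = ⟪((B X Y : ↥Wtᗮ) : V4), N1⟫)
    (hS2 : ∀ X Y : ↥Wt, ⟪((S2 X : ↥Wt) : V4), (Y : V4)⟫ = ⟪((B X Y : ↥Wtᗮ) : V4), N2⟫) :
    η e2 * η e1 - η e1 * η e2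
      = (2 * (‖((B e1 e2 : ↥Wtᗮ) : V4)‖ ^ 2
            - ⟪((B e1 e1 : ↥Wtᗮ) : V4), ((B e2 e2 : ↥Wtᗮ) : V4)⟫))
          • (ι Q4 E1 * ι Q4 E2)
        + (2 * ⟪((S1 (S2 e1) - S2 (S1 e1) : ↥Wt) : V4), (E2 : V4)⟫)
          • (ι Q4 N1 * ι Q4 N2) := by
  have expand (X Y : ↥Wt) := eq_add_of_mem_Wt_orthogonal (B X Y).2
  have inner_expand (X Y Z T : ↥Wt) : ⟪((B X Y : ↥Wtᗮ) : V4), ((B Z T : ↥Wtᗮ) : V4)⟫ =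
      ⟪((B X Y : ↥Wtᗮ) : V4), N1⟫ * ⟪((B Z T : ↥Wtᗮ) : V4), N1⟫ +
        ⟪((B X Y : ↥Wtᗮ) : V4), N2⟫ * ⟪((B Z T : ↥Wtᗮ) : V4), N2⟫ := by
    conv_lhs => rw [expand Z T]
    rw [inner_add_right, inner_smul_right, inner_smul_right]
    ring
  have decomp (w : ↥Wt) : w = ⟪(w : V4), E1⟫ • e1 + ⟪(w : V4), E2⟫ • e2 :=
    Subtype.ext (eq_add_of_mem_Wt w.2)
  have hS : ⟪((S1 (S2 e1) - S2 (S1 e1) : ↥Wt) : V4), (E2 : V4)⟫ =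
      ⟪((B e1 e1 : ↥Wtᗮ) : V4), N2⟫ * ⟪((B e1 e2 : ↥Wtᗮ) : V4), N1⟫ +
        ⟪((B e1 e2 : ↥Wtᗮ) : V4), N2⟫ * ⟪((B e2 e2 : ↥Wtᗮ) : V4), N1⟫ -
        (⟪((B e1 e1 : ↥Wtᗮ) : V4), N1⟫ * ⟪((B e1 e2 : ↥Wtᗮ) : V4), N2⟫ +
          ⟪((B e1 e2 : ↥Wtᗮ) : V4), N1⟫ * ⟪((B e2 e2 : ↥Wtᗮ) : V4), N2⟫) := by
    have h1 := hS1 (S2 e1) e2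
    have h2 := hS2 (S1 e1) e2
    have d1 := decomp (S1 e1)
    have d2 := decomp (S2 e1)
    rw [show ⟪((S1 e1 : ↥Wt) : V4), E1⟫ = _ from hS1 e1 e1,
      show ⟪((S1 e1 : ↥Wt) : V4), E2⟫ = _ from hS1 e1 e2] at d1
    rw [show ⟪((S2 e1 : ↥Wt) : V4), E1⟫ = _ from hS2 e1 e1,
      show ⟪((S2 e1 : ↥Wt) : V4), E2⟫ = _ from hS2 e1 e2] at d2
    rw [Submodule.coe_sub, inner_sub_left]
    refine (congrArg₂ _ h1 h2).trans ?_
    rw [d1, d2]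
    simp only [map_add, map_smul, LinearMap.add_apply, LinearMap.smul_apply, Submodule.coe_add,
      Submodule.coe_smul, inner_add_left, real_inner_smul_left]
  have sq {v : V4} (hv : ⟪v, v⟫ = 1) : ι Q4 v * ι Q4 v = -1 := by
    rw [ι_mul_ι_self_eq_neg_inner, hv, map_neg, map_one]
  have key := commutator_of_anticommuting
    (sq (v := E1) (by simp [E1])) (sq (v := E2) (by simp [E2]))
    (sq (v := N1) (by simp [N1])) (sq (v := N2) (by simp [N2]))
    (ι_mul_ι_eq_neg_of_inner_eq_zero (v := E2) (w := E1)
      (by simp [E1, E2, EuclideanSpace.inner_single_left]))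
    (ι_mul_ι_eq_neg_of_inner_eq_zero (v := N1) (w := E1)
      (by simp [E1, N1, EuclideanSpace.inner_single_left]))
    (ι_mul_ι_eq_neg_of_inner_eq_zero (v := N1) (w := E2)
      (by simp [E2, N1, EuclideanSpace.inner_single_left]))
    (ι_mul_ι_eq_neg_of_inner_eq_zero (v := N2) (w := E1)
      (by simp [E1, N2, EuclideanSpace.inner_single_left]))
    (ι_mul_ι_eq_neg_of_inner_eq_zero (v := N2) (w := E2)
      (by simp [E2, N2, EuclideanSpace.inner_single_left]))
    (ι_mul_ι_eq_neg_of_inner_eq_zero (v := N2) (w := N1)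
      (by simp [N1, N2, EuclideanSpace.inner_single_left]))
    ⟪((B e1 e1 : ↥Wtᗮ) : V4), N1⟫ ⟪((B e1 e1 : ↥Wtᗮ) : V4), N2⟫
    ⟪((B e1 e2 : ↥Wtᗮ) : V4), N1⟫ ⟪((B e1 e2 : ↥Wtᗮ) : V4), N2⟫
    ⟪((B e2 e2 : ↥Wtᗮ) : V4), N1⟫ ⟪((B e2 e2 : ↥Wtᗮ) : V4), N2⟫
  simp only [← map_smul, ← map_add, ← expand] at key
  rw [hη, hη, hBsymm e2 e1, hS, ← real_inner_self_eq_norm_sq, inner_expand, inner_expand,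
    ← pow_two, ← pow_two]
  exact key
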